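/- Under the backward-backward setup with summable errors, if the problem of minimizing Φ over X × X has a solution, then inf{Φ(x,y) : x, y ∈ X} = lim_{n→∞} Φ(Prox_{γf}(Prox_{γg}(x_n)), Prox_{γg}(x_n)) = lim_{n→∞} Φ(Prox_{γf}(y_n), Prox_{γg}(Prox_{γf}(y_n))). -/

import Mathlib

open Set Filter Topology

/-- The objective `Φ(x,y) = f(x) + g(y) + (1/(2γ)) d(x,y)²` of the backward-backward
splitting problem (with `t` playing the role of `γ > 0`). -/
noncomputable def Phi {X : Type*} [MetricSpace X] (f g : X → EReal) (t : ℝ)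
    (x y : X) : EReal :=
  f x + g y + (((1 / (2 * t)) * dist x y ^ 2 : ℝ) : EReal)

/-- The quadrilateral inequality in a space with a nonpositive curvature comparison. -/
theorem dist_sq_add_dist_sq_le_of_comparison {X : Type*} [MetricSpace X] (G : X → X → ℝ → X)
    (hcmp : ∀ x y z : X, ∀ l ∈ Icc (0:ℝ) 1,
      dist z (G x y l) ^ 2 ≤ (1 - l) * dist z x ^ 2 + l * dist z y ^ 2
        - l * (1 - l) * dist x y ^ 2) (a b c d : X) :
    dist a c ^ 2 + dist b d ^ 2
      ≤ dist a b ^ 2 + dist b c ^ 2 + dist c d ^ 2 + dist d a ^ 2 := by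
  have half_mem : (1 / 2 : ℝ) ∈ Icc (0:ℝ) 1 := by constructor <;> norm_num
  have hb := hcmp a c b (1 / 2) half_mem
  have hd := hcmp a c d (1 / 2) half_mem
  set m := G a c (1 / 2)
  have htri : dist b d ≤ dist b m + dist d m := dist_triangle_right b d m
  have hsq : dist b d ^ 2 ≤ (dist b m + dist d m) ^ 2 := by gcongr
  rw [dist_comm a b, dist_comm c d]
  nlinarith [sq_nonneg (dist b m - dist d m)]

/-- A point minimizing `t f + (1/2) d(a, ·)²` lies in the effective domain of a proper `f`. -/
theorem ne_top_of_prox_le {X : Type*} [MetricSpace X] {f : X → EReal}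
    (hproper : ∃ a, f a ≠ ⊤) (hbot : ∀ a, f a ≠ ⊥) {t : ℝ} (ht : 0 < t) {a p : X}
    (hp : ∀ z : X, ((t : ℝ) : EReal) * f p + (((1/2) * dist a p ^ 2 : ℝ) : EReal)
        ≤ ((t : ℝ) : EReal) * f z + (((1/2) * dist a z ^ 2 : ℝ) : EReal)) :
    f p ≠ ⊤ := by
  obtain ⟨z, hz⟩ := hproper
  intro htop
  have h := hp z
  rw [htop, EReal.coe_mul_top_of_pos ht, EReal.top_add_coe] at h
  lift f z to ℝ using ⟨hz, hbot z⟩ with r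
  norm_cast at h

/-- The variational inequality characterizing the proximal point `p` of `a`. -/
theorem prox_variational_inequality {X : Type*} [MetricSpace X] (G : X → X → ℝ → X)
    (hcmp : ∀ x y z : X, ∀ l ∈ Icc (0:ℝ) 1,
      dist z (G x y l) ^ 2 ≤ (1 - l) * dist z x ^ 2 + l * dist z y ^ 2
        - l * (1 - l) * dist x y ^ 2)
    {f : X → EReal} (hbot : ∀ a, f a ≠ ⊥)
    (hconv : ∀ a b : X, ∀ l ∈ Icc (0:ℝ) 1,
      f (G a b l) ≤ ((1 - l : ℝ) : EReal) * f a + ((l : ℝ) : EReal) * f b)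
    {t : ℝ} (ht : 0 < t) {a p : X}
    (hp : ∀ z : X, ((t : ℝ) : EReal) * f p + (((1/2) * dist a p ^ 2 : ℝ) : EReal)
        ≤ ((t : ℝ) : EReal) * f z + (((1/2) * dist a z ^ 2 : ℝ) : EReal))
    (hpt : f p ≠ ⊤) {z : X} (hz : f z ≠ ⊤) :
    t * (f p).toReal + 1 / 2 * dist a p ^ 2 + 1 / 2 * dist p z ^ 2
      ≤ t * (f z).toReal + 1 / 2 * dist a z ^ 2 := by
  have key : ∀ l ∈ Ioc (0:ℝ) 1,
      t * (f p).toReal + 1 / 2 * dist a p ^ 2 + (1 - l) * (1 / 2 * dist p z ^ 2)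
        ≤ t * (f z).toReal + 1 / 2 * dist a z ^ 2 := by
    intro l hl
    have hc := hconv p z l ⟨hl.1.le, hl.2⟩
    have hd := hcmp p z a l ⟨hl.1.le, hl.2⟩
    have hm := hp (G p z l)
    rw [← EReal.coe_toReal hpt (hbot p)] at hc hm
    rw [← EReal.coe_toReal hz (hbot z)] at hc
    have hw : f (G p z l) ≠ ⊤ := by
      intro h
      rw [h] at hc
      norm_cast at hc
    rw [← EReal.coe_toReal hw (hbot _)] at hc hm
    norm_cast at hc hm
    have htc := mul_le_mul_of_nonneg_left hc ht.le
    have hlpos := hl.1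
    refine le_of_mul_le_mul_left ?_ hlpos
    nlinarith
  have hlim : Tendsto (fun l : ℝ => t * (f p).toReal + 1 / 2 * dist a p ^ 2
      + (1 - l) * (1 / 2 * dist p z ^ 2)) (𝓝[>] 0)
      (𝓝 (t * (f p).toReal + 1 / 2 * dist a p ^ 2 + 1 / 2 * dist p z ^ 2)) := by
    have hcont : Continuous (fun l : ℝ => t * (f p).toReal + 1 / 2 * dist a p ^ 2
      + (1 - l) * (1 / 2 * dist p z ^ 2)) := by fun_prop
    refine Tendsto.mono_left ?_ nhdsWithin_le_nhds
    simpa using hcont.tendsto 0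
  refine le_of_tendsto hlim ?_
  filter_upwards [Ioc_mem_nhdsGT (zero_lt_one' ℝ)] with l hl using key l hl

/-- Proximal maps are nonexpansive. -/
theorem dist_prox_le_dist {X : Type*} [MetricSpace X] (G : X → X → ℝ → X)
    (hcmp : ∀ x y z : X, ∀ l ∈ Icc (0:ℝ) 1,
      dist z (G x y l) ^ 2 ≤ (1 - l) * dist z x ^ 2 + l * dist z y ^ 2
        - l * (1 - l) * dist x y ^ 2)
    {f : X → EReal} (hproper : ∃ a, f a ≠ ⊤) (hbot : ∀ a, f a ≠ ⊥)
    (hconv : ∀ a b : X, ∀ l ∈ Icc (0:ℝ) 1,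
      f (G a b l) ≤ ((1 - l : ℝ) : EReal) * f a + ((l : ℝ) : EReal) * f b)
    {t : ℝ} (ht : 0 < t) {prox : X → X}
    (hprox : ∀ a z : X,
      ((t : ℝ) : EReal) * f (prox a) + (((1/2) * dist a (prox a) ^ 2 : ℝ) : EReal)
        ≤ ((t : ℝ) : EReal) * f z + (((1/2) * dist a z ^ 2 : ℝ) : EReal)) (a b : X) :
    dist (prox a) (prox b) ≤ dist a b := by
  have hpa := ne_top_of_prox_le hproper hbot ht (hprox a)
  have hpb := ne_top_of_prox_le hproper hbot ht (hprox b)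
  have ha := prox_variational_inequality G hcmp hbot hconv ht (hprox a) hpa hpb
  have hb := prox_variational_inequality G hcmp hbot hconv ht (hprox b) hpb hpa
  have hq := dist_sq_add_dist_sq_le_of_comparison G hcmp a b (prox b) (prox a)
  rw [dist_comm (prox b) (prox a)] at hb hq
  rw [dist_comm (prox a) a] at hq
  refine le_of_sq_le_sq ?_ dist_nonneg
  linarith

/-- A nonnegative sequence that decreases up to summable errors converges. -/
theorem exists_tendsto_of_le_add_summable {D e : ℕ → ℝ} (hD : ∀ n, 0 ≤ D n)
    (he : ∀ n, 0 ≤ e n) (hsum : Summable e) (hstep : ∀ n, D (n + 1) ≤ D n + e n) :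
    ∃ L, Tendsto D atTop (𝓝 L) := by
  have hanti : Antitone (fun n => D n - ∑ i ∈ Finset.range n, e i) := by
    refine antitone_nat_of_succ_le fun n => ?_
    rw [Finset.sum_range_succ]
    linarith [hstep n]
  have hbdd : BddBelow (range fun n => D n - ∑ i ∈ Finset.range n, e i) := by
    refine ⟨-∑' i, e i, ?_⟩
    rintro _ ⟨n, rfl⟩
    have := hsum.sum_le_tsum (Finset.range n) fun i _ => he i
    dsimp only
    linarith [hD n]
  refine ⟨_, ((tendsto_atTop_ciInf hanti hbdd).add hsum.hasSum.tendsto_sum_nat).congr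
    fun n => ?_⟩
  ring

/-- `Phi` at points of the effective domains is a real number. -/
theorem Phi_eq_coe {X : Type*} [MetricSpace X] {f g : X → EReal} {t : ℝ} {a b : X}
    (hfa : f a ≠ ⊤) (hfa' : f a ≠ ⊥) (hgb : g b ≠ ⊤) (hgb' : g b ≠ ⊥) :
    Phi f g t a b
      = (((f a).toReal + (g b).toReal + (1 / (2 * t)) * dist a b ^ 2 : ℝ) : EReal) := by
  rw [Phi, ← EReal.coe_toReal hfa hfa', ← EReal.coe_toReal hgb hgb']
  norm_cast

/-- Exchanging the two functions and the two variables leaves `Phi` unchanged. -/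
theorem Phi_swap {X : Type*} [MetricSpace X] (f g : X → EReal) (t : ℝ) (a b : X) :
    Phi g f t b a = Phi f g t a b := by
  rw [Phi, Phi, add_comm (g b), dist_comm]

/-- A minimizer of `Phi` lies in the product of the effective domains. -/
theorem ne_top_of_Phi_minimizer {X : Type*} [MetricSpace X] {f g : X → EReal} {t : ℝ}
    (hfproper : ∃ a, f a ≠ ⊤) (hfbot : ∀ a, f a ≠ ⊥)
    (hgproper : ∃ a, g a ≠ ⊤) (hgbot : ∀ a, g a ≠ ⊥) {p q : X}
    (hmin : ∀ a b : X, Phi f g t p q ≤ Phi f g t a b) : f p ≠ ⊤ ∧ g q ≠ ⊤ := by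
  obtain ⟨a, ha⟩ := hfproper
  obtain ⟨b, hb⟩ := hgproper
  have h := hmin a b
  rw [Phi_eq_coe ha (hfbot a) hb (hgbot b)] at h
  have hlt : Phi f g t p q ≠ ⊤ := (h.trans_lt (EReal.coe_lt_top _)).ne
  constructor
  · intro hp
    rw [Phi, hp, EReal.top_add_of_ne_bot (hgbot q), EReal.top_add_coe] at hlt
    exact hlt rfl
  · intro hq
    rw [Phi, hq, EReal.add_top_of_ne_bot (hfbot p), EReal.top_add_coe] at hlt
    exact hlt rfl

/-- The values of `Phi` at the exact backward-backward steps from the inexact iterates `x n`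
converge to the minimum. -/
theorem tendsto_Phi_prox_prox {X : Type*} [MetricSpace X] (G : X → X → ℝ → X)
    (hcmp : ∀ x y z : X, ∀ l ∈ Icc (0:ℝ) 1,
      dist z (G x y l) ^ 2 ≤ (1 - l) * dist z x ^ 2 + l * dist z y ^ 2
        - l * (1 - l) * dist x y ^ 2)
    {f g : X → EReal}
    (hfproper : ∃ a, f a ≠ ⊤) (hfbot : ∀ a, f a ≠ ⊥)
    (hfconv : ∀ a b : X, ∀ l ∈ Icc (0:ℝ) 1,
      f (G a b l) ≤ ((1 - l : ℝ) : EReal) * f a + ((l : ℝ) : EReal) * f b)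
    (hgproper : ∃ a, g a ≠ ⊤) (hgbot : ∀ a, g a ≠ ⊥)
    (hgconv : ∀ a b : X, ∀ l ∈ Icc (0:ℝ) 1,
      g (G a b l) ≤ ((1 - l : ℝ) : EReal) * g a + ((l : ℝ) : EReal) * g b)
    {t : ℝ} (ht : 0 < t) {proxf proxg : X → X}
    (hproxf : ∀ a z : X,
      ((t : ℝ) : EReal) * f (proxf a) + (((1/2) * dist a (proxf a) ^ 2 : ℝ) : EReal)
        ≤ ((t : ℝ) : EReal) * f z + (((1/2) * dist a z ^ 2 : ℝ) : EReal))
    (hproxg : ∀ a z : X,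
      ((t : ℝ) : EReal) * g (proxg a) + (((1/2) * dist a (proxg a) ^ 2 : ℝ) : EReal)
        ≤ ((t : ℝ) : EReal) * g z + (((1/2) * dist a z ^ 2 : ℝ) : EReal))
    {x y : ℕ → X}
    (herr₁ : Summable (fun n => dist (y n) (proxg (x n))))
    (herr₂ : Summable (fun n => dist (x (n + 1)) (proxf (y n))))
    {p q : X} (hmin : ∀ a b : X, Phi f g t p q ≤ Phi f g t a b) :
    Tendsto (fun n => Phi f g t (proxf (proxg (x n))) (proxg (x n))) atTop
      (𝓝 (Phi f g t p q)) := by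
  obtain ⟨hp, hq⟩ := ne_top_of_Phi_minimizer hfproper hfbot hgproper hgbot hmin
  have hproxf_top := fun a => ne_top_of_prox_le hfproper hfbot ht (hproxf a)
  have hproxg_top := fun a => ne_top_of_prox_le hgproper hgbot ht (hproxg a)
  have hPhi := fun n => Phi_eq_coe (t := t) (hproxf_top (proxg (x n))) (hfbot _)
    (hproxg_top (x n)) (hgbot _)
  have hPhi_min := Phi_eq_coe (t := t) hp (hfbot p) hq (hgbot q)
  set v : ℕ → X := fun n => proxf (proxg (x n))
  set φ : ℕ → ℝ := fun n => (f (v n)).toReal + (g (proxg (x n))).toReal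
    + (1 / (2 * t)) * dist (v n) (proxg (x n)) ^ 2
  set m : ℝ := (f p).toReal + (g q).toReal + (1 / (2 * t)) * dist p q ^ 2
  have hlower : ∀ n, m ≤ φ n := fun n => by
    have h := hmin (v n) (proxg (x n))
    rw [hPhi n, hPhi_min] at h
    exact_mod_cast h
  have hupper : ∀ n, φ n ≤ m + (1 / (2 * t)) * (dist (x n) p ^ 2 - dist (v n) p ^ 2) := by
    intro n
    have hg := prox_variational_inequality G hcmp hgbot hgconv ht (hproxg (x n))
      (hproxg_top _) hq
    have hf := prox_variational_inequality G hcmp hfbot hfconv ht (hproxf (proxg (x n)))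
      (hproxf_top _) hp
    have hquad := dist_sq_add_dist_sq_le_of_comparison G hcmp (x n) (proxg (x n)) q p
    rw [dist_comm q p, dist_comm p (x n)] at hquad
    rw [dist_comm (proxg (x n)) (proxf _)] at hf
    refine le_of_mul_le_mul_left ?_ ht
    have hcancel : ∀ r : ℝ, t * ((1 / (2 * t)) * r) = 1 / 2 * r := fun r => by field_simp
    simp only [φ, m, mul_add, hcancel]
    linarith
  have hdecr : ∀ n, dist (v n) p ≤ dist (x n) p := by
    intro n
    have h : 0 ≤ (1 / (2 * t)) * (dist (x n) p ^ 2 - dist (v n) p ^ 2) := by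
      linarith [hlower n, hupper n]
    have h2 := nonneg_of_mul_nonneg_right h (by positivity)
    exact le_of_sq_le_sq (by linarith) dist_nonneg
  set e : ℕ → ℝ := fun n => dist (y n) (proxg (x n)) + dist (x (n + 1)) (proxf (y n))
  have he : Summable e := herr₁.add herr₂
  have hdist : ∀ n, dist (x (n + 1)) (v n) ≤ e n := fun n => by
    have h1 := dist_triangle (x (n + 1)) (proxf (y n)) (v n)
    have h2 := dist_prox_le_dist G hcmp hfproper hfbot hfconv ht hproxf (y n) (proxg (x n))
    simp only [e, v] at h1 ⊢
    linarith
  obtain ⟨L, hL⟩ := exists_tendsto_of_le_add_summable (D := fun n => dist (x n) p)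
    (fun n => dist_nonneg) (fun n => by positivity) he fun n => by
      linarith [dist_triangle (x (n + 1)) (v n) p, hdist n, hdecr n]
  have hvL : Tendsto (fun n => dist (v n) p) atTop (𝓝 L) := by
    have hlow : Tendsto (fun n => dist (x (n + 1)) p - e n) atTop (𝓝 L) := by
      simpa using (hL.comp (tendsto_add_atTop_nat 1)).sub he.tendsto_atTop_zero
    refine tendsto_of_tendsto_of_tendsto_of_le_of_le hlow hL (fun n => ?_) hdecr
    dsimp only
    linarith [dist_triangle (x (n + 1)) (v n) p, hdist n]
  have hφ : Tendsto φ atTop (𝓝 m) := by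
    refine tendsto_of_tendsto_of_tendsto_of_le_of_le tendsto_const_nhds ?_ hlower hupper
    simpa using (((hL.pow 2).sub (hvL.pow 2)).const_mul (1 / (2 * t))).const_add m
  rw [hPhi_min]
  exact (((continuous_coe_real_ereal.tendsto m).comp hφ).congr fun n => (hPhi n).symm)

/-- Backward-backward setup with summable errors: if `Φ` has a
minimizer over `X × X`, then `inf Φ = lim_n Φ(Prox_{γf}(Prox_{γg} x_n), Prox_{γg} x_n)
= lim_n Φ(Prox_{γf} y_n, Prox_{γg}(Prox_{γf} y_n))`. -/
theorem bb_values_tendsto_inf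
    {X : Type*} [MetricSpace X] [CompleteSpace X]
    (G : X → X → ℝ → X)
    (hG0 : ∀ x y, G x y 0 = x) (hG1 : ∀ x y, G x y 1 = y)
    (hGd : ∀ x y, ∀ s ∈ Icc (0:ℝ) 1, ∀ u ∈ Icc (0:ℝ) 1,
      dist (G x y s) (G x y u) = |s - u| * dist x y)
    (hcmp : ∀ x y z : X, ∀ l ∈ Icc (0:ℝ) 1,
      dist z (G x y l) ^ 2 ≤ (1 - l) * dist z x ^ 2 + l * dist z y ^ 2
        - l * (1 - l) * dist x y ^ 2)
    (f g : X → EReal)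
    (hfproper : ∃ a, f a ≠ ⊤) (hfbot : ∀ a, f a ≠ ⊥)
    (hfconv : ∀ a b : X, ∀ l ∈ Icc (0:ℝ) 1,
      f (G a b l) ≤ ((1 - l : ℝ) : EReal) * f a + ((l : ℝ) : EReal) * f b)
    (hflsc : LowerSemicontinuous f)
    (hgproper : ∃ a, g a ≠ ⊤) (hgbot : ∀ a, g a ≠ ⊥)
    (hgconv : ∀ a b : X, ∀ l ∈ Icc (0:ℝ) 1,
      g (G a b l) ≤ ((1 - l : ℝ) : EReal) * g a + ((l : ℝ) : EReal) * g b)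
    (hglsc : LowerSemicontinuous g)
    (t : ℝ) (ht : 0 < t)
    -- `proxf x = Prox_{t·f}(x)` and `proxg x = Prox_{t·g}(x)`:
    (proxf proxg : X → X)
    (hproxf : ∀ a z : X,
      ((t : ℝ) : EReal) * f (proxf a) + (((1/2) * dist a (proxf a) ^ 2 : ℝ) : EReal)
        ≤ ((t : ℝ) : EReal) * f z + (((1/2) * dist a z ^ 2 : ℝ) : EReal))
    (hproxg : ∀ a z : X,
      ((t : ℝ) : EReal) * g (proxg a) + (((1/2) * dist a (proxg a) ^ 2 : ℝ) : EReal)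
        ≤ ((t : ℝ) : EReal) * g z + (((1/2) * dist a z ^ 2 : ℝ) : EReal))
    (x y : ℕ → X)
    (herr₁ : Summable (fun n => dist (y n) (proxg (x n))))
    (herr₂ : Summable (fun n => dist (x (n + 1)) (proxf (y n))))
    (hsol : ∃ p : X × X, ∀ a b : X, Phi f g t p.1 p.2 ≤ Phi f g t a b) :
    Tendsto (fun n => Phi f g t (proxf (proxg (x n))) (proxg (x n))) atTop
      (nhds (⨅ p : X × X, Phi f g t p.1 p.2)) ∧
    Tendsto (fun n => Phi f g t (proxf (y n)) (proxg (proxf (y n)))) atTop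
      (nhds (⨅ p : X × X, Phi f g t p.1 p.2)) := by
  obtain ⟨⟨p, q⟩, hmin⟩ := hsol
  have hinf : (⨅ r : X × X, Phi f g t r.1 r.2) = Phi f g t p q :=
    le_antisymm (iInf_le _ (p, q)) (le_iInf fun r => hmin r.1 r.2)
  rw [hinf]
  refine ⟨tendsto_Phi_prox_prox G hcmp hfproper hfbot hfconv hgproper hgbot hgconv ht
    hproxf hproxg herr₁ herr₂ hmin, ?_⟩
  have h := tendsto_Phi_prox_prox G hcmp hgproper hgbot hgconv hfproper hfbot hfconv ht
    hproxg hproxf herr₂ ((summable_nat_add_iff 1).2 herr₁) (p := q) (q := p)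
    fun a b => by simpa only [Phi_swap f g] using hmin b a
  simpa only [Phi_swap f g] using h
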